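/- arXiv:2201.11315 — 4 statements merged into one kernel-verified Lean document; each statement's English description precedes it below -/
import Mathlib

section
/- For every nonempty open subset Ω ⊆ ℂ, the ring O(Ω) of holomorphic functions on Ω is not a Noetherian ring. -/
open Set

open scoped Classical

/-- The extension by zero of a function `g : Ω → ℂ` to all of `ℂ`. -/
noncomputable def extendByZero (Ω : Set ℂ) (g : Ω → ℂ) : ℂ → ℂ :=
  fun z => if h : z ∈ Ω then g ⟨z, h⟩ else 0

/-- The ring `O(Ω)` of holomorphic functions on `Ω`, realized as the subring of `Ω → ℂ`
consisting of the functions that are complex-differentiable at every point of `Ω`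
(equivalently, whose extension by zero is differentiable on the open set `Ω`),
with pointwise addition and multiplication. -/
noncomputable def holomorphicRing (Ω : Set ℂ) : Subring (Ω → ℂ) where
  carrier := {g | DifferentiableOn ℂ (extendByZero Ω g) Ω}
  zero_mem' := (differentiableOn_const 0).congr fun z hz => by
    simp [extendByZero, dif_pos hz]
  one_mem' := (differentiableOn_const 1).congr fun z hz => by
    simp [extendByZero, dif_pos hz]
  add_mem' := fun {a b} ha hb => (ha.add hb).congr fun z hz => by
    simp [extendByZero, dif_pos hz]
  mul_mem' := fun {a b} ha hb => (ha.mul hb).congr fun z hz => by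
    simp [extendByZero, dif_pos hz]
  neg_mem' := fun {a} ha => ha.neg.congr fun z hz => by
    simp [extendByZero, dif_pos hz]

/-- A commutative ring with homomorphisms `ev k` to a field and elements `g n` such that
`ev k (g n)` vanishes exactly when `k ≠ n` is not Noetherian. -/
theorem not_isNoetherianRing_of_separating_homs {R K : Type*} [CommRing R] [Field K]
    (ev : ℕ → R →+* K) (g : ℕ → R) (hg : ∀ n, ev n (g n) ≠ 0)
    (hg' : ∀ n k, k ≠ n → ev k (g n) = 0) : ¬ IsNoetherianRing R := by
  intro h
  let I : ℕ →o Ideal R :=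
    { toFun := fun n => ⨅ k ≥ n, RingHom.ker (ev k)
      monotone' := fun m n hmn => le_iInf₂ fun k hk => iInf₂_le k (hmn.trans hk) }
  have mem_I (n : ℕ) (r : R) : r ∈ I n ↔ ∀ k ≥ n, ev k r = 0 := by
    simp [I, Submodule.mem_iInf, RingHom.mem_ker]
  obtain ⟨n, hn⟩ := monotone_stabilizes_iff_noetherian.mpr h I
  have hmem : g n ∈ I (n + 1) := (mem_I _ _).2 fun k hk => hg' n k (by lia)
  rw [← hn (n + 1) n.le_succ] at hmem
  exact hg n ((mem_I _ _).1 hmem n le_rfl)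

theorem restrict_mem_holomorphicRing {Ω : Set ℂ} {f : ℂ → ℂ} (hf : DifferentiableOn ℂ f Ω) :
    (fun z : Ω => f z) ∈ holomorphicRing Ω :=
  hf.congr fun z hz => by simp [extendByZero, dif_pos hz]

theorem holomorphicRing_not_noetherian_of_map {Ω : Set ℂ} {φ : ℂ → ℂ}
    (hφ : DifferentiableOn ℂ φ Ω) (z : ℕ → Ω)
    (hz : ∀ n : ℕ, φ (z n) = (n + 1 : ℕ) * (Real.pi : ℂ)) :
    ¬ IsNoetherianRing (holomorphicRing Ω) := by
  have hd (c : ℂ) : Differentiable ℂ (dslope Complex.sin c) := by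
    rw [← differentiableOn_univ, Complex.differentiableOn_dslope Filter.univ_mem]
    exact Complex.differentiable_sin.differentiableOn
  refine not_isNoetherianRing_of_separating_homs
    (fun k => (Pi.evalRingHom (fun _ : Ω => ℂ) (z k)).comp (holomorphicRing Ω).subtype)
    (fun n => ⟨_, restrict_mem_holomorphicRing
      ((hd ((n + 1 : ℕ) * (Real.pi : ℂ))).comp_differentiableOn hφ)⟩) (fun n => ?_)
    (fun n k hkn => ?_)
  · have hcos : Complex.cos ((n + 1 : ℕ) * (Real.pi : ℂ)) ≠ 0 := by
      intro h
      have hsq := Complex.sin_sq_add_cos_sq ((n + 1 : ℕ) * (Real.pi : ℂ))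
      simp [h, Complex.sin_nat_mul_pi, -Nat.cast_add] at hsq
    simpa [hz, dslope_same, -Nat.cast_add] using hcos
  · have hne : ((k + 1 : ℕ) * (Real.pi : ℂ)) ≠ (n + 1 : ℕ) * (Real.pi : ℂ) := by
      simpa [Real.pi_ne_zero] using hkn
    simp [hz, dslope_of_ne _ hne, slope, Complex.sin_nat_mul_pi, -Nat.cast_add]

/--
For every nonempty open subset `Ω ⊆ ℂ`, the ring `O(Ω)` of holomorphic functions on `Ω`
is not a Noetherian ring.
-/
theorem holomorphicRing_not_noetherian
    (Ω : Set ℂ) (hne : Ω.Nonempty) (hΩ : IsOpen Ω) :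
    ¬ IsNoetherianRing (holomorphicRing Ω) := by
  rcases (Ωᶜ).eq_empty_or_nonempty with hempty | hcompl
  · have huniv : Ω = univ := by simpa using hempty
    exact holomorphicRing_not_noetherian_of_map differentiableOn_id
      (fun n => ⟨(n + 1 : ℕ) * (Real.pi : ℂ), huniv ▸ mem_univ _⟩) fun n => rfl
  obtain ⟨p, hp⟩ := hne
  -- The half-open segment from `p` to a nearest point `a` of the complement lies in `Ω`.
  obtain ⟨a, ha, hpa⟩ := hΩ.isClosed_compl.exists_infDist_eq_dist hcompl p
  have hpa_ne : p - a ≠ 0 := sub_ne_zero.2 fun h => ha (h ▸ hp)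
  have hseg (t : ℝ) (ht : 1 < t) : a + (p - a) / t ∈ Ω := by
    by_contra hmem
    have hle : dist p a ≤ dist p (a + (p - a) / t) :=
      hpa ▸ Metric.infDist_le_dist_of_mem hmem
    have htC : (t : ℂ) ≠ 0 := by exact_mod_cast (by linarith : t ≠ 0)
    have heq : p - (a + (p - a) / t) = ((1 - t⁻¹ : ℝ) : ℂ) * (p - a) := by
      push_cast
      field_simp
      ring
    have hinv : 0 < t⁻¹ := by positivity
    have hinv' : t⁻¹ < 1 := inv_lt_one_of_one_lt₀ ht
    rw [dist_eq_norm, dist_eq_norm, heq, norm_mul, Complex.norm_real,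
      Real.norm_of_nonneg (by linarith)] at hle
    nlinarith [norm_pos_iff.2 hpa_ne]
  have hpi (n : ℕ) : 1 < ((n + 1 : ℕ) : ℝ) * Real.pi := by
    push_cast
    nlinarith [Real.pi_gt_three, (n.cast_nonneg : (0 : ℝ) ≤ n)]
  refine holomorphicRing_not_noetherian_of_map (φ := fun z => (p - a) / (z - a)) ?_
    (fun n => ⟨_, hseg _ (hpi n)⟩) fun n => ?_
  · exact (differentiableOn_const _).div (differentiableOn_id.sub_const a)
      fun z hz => sub_ne_zero.2 fun h => ha (h ▸ hz)
  · simp only [add_sub_cancel_left, div_div_cancel₀ hpa_ne]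
    push_cast
    rfl
end

section
/- Let 𝒞 ⊂ [0,1] ⊂ ℂ be the ternary Cantor set. Let Γ(𝒞, O) denote the ring of germs of holomorphic functions along 𝒞, i.e., the direct limit over all open sets U ⊆ ℂ containing 𝒞 of the rings O(U) of holomorphic functions on U, with restriction maps as transition maps (equivalently, the subring of germs at the neighborhood filter of 𝒞 represented by functions holomorphic on some open neighborhood of 𝒞). For each n ∈ ℕ let 𝔞_n = {[f] ∈ Γ(𝒞, O) : f(z) = 0 for every z ∈ 𝒞 ∩ [0, 3⁻ⁿ]}, a condition independent of the chosen representative f. Then each 𝔞_n is an ideal of Γ(𝒞, O) and 𝔞_n ⊊ 𝔞_{n+1} for every n ∈ ℕ; in particular the ring Γ(𝒞, O) is not Noetherian. -/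
open Filter Set

/-- The ternary Cantor set, regarded as a compact subset of `ℂ` (via the inclusion `ℝ ⊆ ℂ`). -/
def cantorSetC : Set ℂ := Complex.ofReal '' cantorSet

/-- The ring `Γ(𝒞, O)` of germs of holomorphic functions along the Cantor set `𝒞 ⊂ ℂ`:
the subring of the ring of germs of functions at the neighborhood filter of `𝒞` consisting of
those germs represented by a function holomorphic on some open neighborhood of `𝒞`.
(This is the direct limit, over the open sets `U ⊇ 𝒞`, of the rings `O(U)`.) -/
noncomputable def cantorGerms : Subring (Filter.Germ (nhdsSet cantorSetC) ℂ) where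
  carrier := {γ | ∃ U : Set ℂ, IsOpen U ∧ cantorSetC ⊆ U ∧
      ∃ f : ℂ → ℂ, DifferentiableOn ℂ f U ∧ γ = (f : Filter.Germ (nhdsSet cantorSetC) ℂ)}
  zero_mem' := ⟨Set.univ, isOpen_univ, Set.subset_univ _, fun _ => 0,
    differentiableOn_const 0, rfl⟩
  one_mem' := ⟨Set.univ, isOpen_univ, Set.subset_univ _, fun _ => 1,
    differentiableOn_const 1, rfl⟩
  add_mem' := by
    rintro a b ⟨U, hU, hCU, f, hf, rfl⟩ ⟨V, hV, hCV, g, hg, rfl⟩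
    exact ⟨U ∩ V, hU.inter hV, Set.subset_inter hCU hCV, f + g,
      (hf.mono Set.inter_subset_left).add (hg.mono Set.inter_subset_right), by simp⟩
  mul_mem' := by
    rintro a b ⟨U, hU, hCU, f, hf, rfl⟩ ⟨V, hV, hCV, g, hg, rfl⟩
    exact ⟨U ∩ V, hU.inter hV, Set.subset_inter hCU hCV, f * g,
      (hf.mono Set.inter_subset_left).mul (hg.mono Set.inter_subset_right), by simp⟩
  neg_mem' := by
    rintro a ⟨U, hU, hCU, f, hf, rfl⟩
    exact ⟨U, hU, hCU, -f, hf.neg, by simp⟩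

/-- The ideal `𝔞_n` of `Γ(𝒞, O)` consisting of the germs `[f]` such that `f(z) = 0` for every
`z ∈ 𝒞 ∩ [0, 3⁻ⁿ]` (a condition independent of the chosen representative `f`). -/
noncomputable def cantorVanishingIdeal (n : ℕ) : Ideal cantorGerms where
  carrier := {γ | ∃ f : ℂ → ℂ,
      (f : Filter.Germ (nhdsSet cantorSetC) ℂ) = (γ : Filter.Germ (nhdsSet cantorSetC) ℂ) ∧
      ∀ z ∈ cantorSetC ∩ (Complex.ofReal '' Set.Icc (0 : ℝ) (((3 : ℝ) ^ n)⁻¹)), f z = 0}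
  zero_mem' := ⟨fun _ => 0, rfl, fun _ _ => rfl⟩
  add_mem' := by
    rintro a b ⟨f, hf, hf0⟩ ⟨g, hg, hg0⟩
    refine ⟨f + g, by simp [hf, hg], fun z hz => by simp [hf0 z hz, hg0 z hz]⟩
  smul_mem' := by
    rintro c x ⟨f, hf, hf0⟩
    obtain ⟨U, hU, hCU, g, hg, hgc⟩ := c.2
    refine ⟨g * f, by simp [hf, ← hgc, smul_eq_mul], fun z hz => by simp [hf0 z hz]⟩

/-- The Cantor set has no points in the open interval `(3⁻⁽ⁿ⁺¹⁾, 2 * 3⁻⁽ⁿ⁺¹⁾)`. -/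
theorem cantorSet_le_or_ge_of_mem (n : ℕ) {x : ℝ} (hx : x ∈ cantorSet) :
    x ≤ ((3 : ℝ) ^ (n + 1))⁻¹ ∨ 2 * ((3 : ℝ) ^ (n + 1))⁻¹ ≤ x := by
  induction n generalizing x with
  | zero =>
    rw [cantorSet_eq_union_halves] at hx
    rcases hx with ⟨y, hy, rfl⟩ | ⟨y, hy, rfl⟩ <;>
      have := cantorSet_subset_unitInterval hy
    · left; norm_num; linarith [this.2]
    · right; norm_num; linarith [this.1]
  | succ n ih =>
    rw [cantorSet_eq_union_halves] at hx
    have hpow : ((3 : ℝ) ^ (n + 1 + 1))⁻¹ = ((3 : ℝ) ^ (n + 1))⁻¹ / 3 := by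
      rw [pow_succ _ (n + 1), mul_inv]; rfl
    rw [hpow]
    rcases hx with ⟨y, hy, rfl⟩ | ⟨y, hy, rfl⟩
    · rcases ih hy with h | h
      · left; dsimp only; linarith
      · right; dsimp only; linarith
    · right
      have h0 := (cantorSet_subset_unitInterval hy).1
      have h1 : ((3 : ℝ) ^ (n + 1))⁻¹ ≤ 1 := inv_le_one_of_one_le₀ (one_le_pow₀ (by norm_num))
      dsimp only
      linarith

/-- The Cantor set contains `3/4 * 3⁻ⁿ` for every `n`. -/
theorem three_quarters_mul_inv_pow_mem_cantorSet (n : ℕ) :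
    3 / 4 * ((3 : ℝ) ^ n)⁻¹ ∈ cantorSet := by
  induction n with
  | zero => simpa [cantorSet] using fun i => (quarters_mem_preCantorSet i).2
  | succ n ih =>
    rw [cantorSet_eq_union_halves]
    exact Or.inl ⟨_, ih, by dsimp only; rw [pow_succ, mul_inv]; ring⟩

/-- The value at a point of `𝒞` depends only on the germ along `𝒞`. -/
theorem eq_of_germ_eq_of_mem_cantorSetC {f g : ℂ → ℂ}
    (h : (f : Germ (nhdsSet cantorSetC) ℂ) = (g : Germ (nhdsSet cantorSetC) ℂ))
    {z : ℂ} (hz : z ∈ cantorSetC) : f z = g z :=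
  (Germ.coe_eq.mp h).self_of_nhdsSet hz

theorem mem_cantorVanishingIdeal_iff (n : ℕ) (γ : cantorGerms) :
    γ ∈ cantorVanishingIdeal n ↔
      ∀ f : ℂ → ℂ,
        (f : Germ (nhdsSet cantorSetC) ℂ) = (γ : Germ (nhdsSet cantorSetC) ℂ) →
        ∀ z ∈ cantorSetC ∩ (Complex.ofReal '' Icc (0 : ℝ) (((3 : ℝ) ^ n)⁻¹)), f z = 0 := by
  constructor
  · rintro ⟨g, hg, hg0⟩ f hf z hz
    rw [eq_of_germ_eq_of_mem_cantorSetC (hf.trans hg.symm) hz.1, hg0 z hz]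
  · intro h
    obtain ⟨U, -, -, f, -, hf⟩ := γ.2
    exact ⟨f, hf.symm, h f hf.symm⟩

/-- The locally constant function equal to `0` on `re z < c` and to `1` on `c ≤ re z`. -/
noncomputable def reStep (c : ℝ) (z : ℂ) : ℂ := if z.re < c then 0 else 1

theorem differentiableOn_reStep (c : ℝ) : DifferentiableOn ℂ (reStep c) {z | z.re ≠ c} := by
  intro z hz
  apply DifferentiableAt.differentiableWithinAt
  rcases lt_or_gt_of_ne hz with h | h
  · refine (differentiableAt_const (0 : ℂ)).congr_of_eventuallyEq ?_
    filter_upwards [Complex.continuous_re.continuousAt.eventually_lt_const h] with w hw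
    exact if_pos hw
  · refine (differentiableAt_const (1 : ℂ)).congr_of_eventuallyEq ?_
    filter_upwards [Complex.continuous_re.continuousAt.eventually_const_lt h] with w hw
    exact if_neg hw.not_gt

theorem coe_reStep_mem_cantorGerms {c : ℝ} (hc : c ∉ cantorSet) :
    (reStep c : Germ (nhdsSet cantorSetC) ℂ) ∈ cantorGerms := by
  refine ⟨{z | z.re ≠ c}, isOpen_ne_fun Complex.continuous_re continuous_const, ?_,
    reStep c, differentiableOn_reStep c, rfl⟩
  rintro _ ⟨x, hx, rfl⟩ rfl
  exact hc hx

theorem cantorVanishingIdeal_lt_succ (n : ℕ) :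
    cantorVanishingIdeal n < cantorVanishingIdeal (n + 1) := by
  have hpos : 0 < ((3 : ℝ) ^ (n + 1))⁻¹ := by positivity
  have hpow : ((3 : ℝ) ^ n)⁻¹ = 3 * ((3 : ℝ) ^ (n + 1))⁻¹ := by
    rw [pow_succ, mul_inv]; ring
  have hc : 3 / 2 * ((3 : ℝ) ^ (n + 1))⁻¹ ∉ cantorSet := fun h => by
    rcases cantorSet_le_or_ge_of_mem n h with h | h <;> linarith
  refine SetLike.lt_iff_le_and_exists.mpr
    ⟨?_, ⟨_, coe_reStep_mem_cantorGerms hc⟩, ?_, fun hmem => ?_⟩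
  · rintro γ ⟨f, hf, hf0⟩
    refine ⟨f, hf, fun z hz => hf0 z ⟨hz.1, image_mono (Icc_subset_Icc_right ?_) hz.2⟩⟩
    linarith
  · refine ⟨_, rfl, ?_⟩
    rintro _ ⟨-, x, hx, rfl⟩
    exact if_pos (by rw [Complex.ofReal_re]; linarith [hx.2])
  · have h := (mem_cantorVanishingIdeal_iff n _).mp hmem _ rfl
      ((3 / 4 * ((3 : ℝ) ^ n)⁻¹ : ℝ) : ℂ)
      ⟨mem_image_of_mem _ (three_quarters_mul_inv_pow_mem_cantorSet n),
        mem_image_of_mem _ ⟨by positivity, by linarith⟩⟩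
    rw [reStep, if_neg (by rw [Complex.ofReal_re]; linarith)] at h
    exact one_ne_zero h

/--
Let `𝒞 ⊂ [0,1] ⊂ ℂ` be the ternary Cantor set, and let `Γ(𝒞, O)` be the ring of germs of
holomorphic functions along `𝒞`.  For each `n ∈ ℕ` let
`𝔞_n = {[f] ∈ Γ(𝒞, O) : f(z) = 0 for every z ∈ 𝒞 ∩ [0, 3⁻ⁿ]}`.  Then this condition is
independent of the chosen representative `f`, each `𝔞_n` is an ideal of `Γ(𝒞, O)`, and
`𝔞_n ⊊ 𝔞_{n+1}` for every `n ∈ ℕ`; in particular the ring `Γ(𝒞, O)` is not Noetherian.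
-/
theorem cantorGerms_strict_chain_and_not_noetherian :
    (∀ (n : ℕ) (γ : cantorGerms),
      γ ∈ cantorVanishingIdeal n ↔
        ∀ f : ℂ → ℂ,
          (f : Filter.Germ (nhdsSet cantorSetC) ℂ) = (γ : Filter.Germ (nhdsSet cantorSetC) ℂ) →
          ∀ z ∈ cantorSetC ∩ (Complex.ofReal '' Set.Icc (0 : ℝ) (((3 : ℝ) ^ n)⁻¹)), f z = 0) ∧
    (∀ n : ℕ, cantorVanishingIdeal n < cantorVanishingIdeal (n + 1)) ∧
    ¬ IsNoetherianRing cantorGerms := by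
  refine ⟨mem_cantorVanishingIdeal_iff, cantorVanishingIdeal_lt_succ, fun hN => ?_⟩
  exact not_strictMono_of_wellFoundedGT cantorVanishingIdeal
    (strictMono_nat_of_lt_succ cantorVanishingIdeal_lt_succ)
end

section
/- Let D : ℂ → ℤ be a function whose support {z ∈ ℂ : D(z) ≠ 0} is a closed, discrete subset of ℂ. Then there exists a function f, meromorphic on all of ℂ and not identically zero, such that for every z ∈ ℂ the order of f at z equals D(z); here the order of f at z is the integer d such that f(w) = (w − z)^d · g(w) near z with g holomorphic and nonvanishing at z (so poles have negative order, and order 0 means f is holomorphic and nonzero at z). -/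
open Filter Metric Topology

/-- A function holomorphic on a disc is uniformly approximated by entire functions on every
smaller concentric disc. -/
theorem DifferentiableOn.exists_differentiable_norm_sub_le {L : ℂ → ℂ} {r R ε : ℝ}
    (hL : DifferentiableOn ℂ L (ball 0 R)) (hr : r < R) (hε : 0 < ε) :
    ∃ p : ℂ → ℂ, Differentiable ℂ p ∧ ∀ w ∈ ball (0 : ℂ) r, ‖L w - p w‖ ≤ ε := by
  rcases le_or_gt r 0 with hr0 | hr0
  · exact ⟨0, differentiable_const 0, by simp [ball_eq_empty.2 hr0]⟩
  obtain ⟨t, hrt, htR⟩ := exists_between hr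
  lift r to NNReal using hr0.le
  lift t to NNReal using hr0.le.trans hrt.le
  have hseries := (hL.mono (closedBall_subset_ball htR)).hasFPowerSeriesOnBall
    (NNReal.coe_pos.1 (hr0.trans hrt))
  have hunif := hseries.tendstoUniformlyOn (r' := r) (by exact_mod_cast hrt)
  obtain ⟨n, hn⟩ := (tendstoUniformlyOn_iff.1 hunif ε hε).exists
  refine ⟨fun w ↦ (cauchyPowerSeries L 0 t).partialSum n w, ?_, fun w hw ↦ ?_⟩
  · simp only [FormalMultilinearSeries.partialSum, FormalMultilinearSeries.apply_eq_pow_smul_coeff]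
    fun_prop
  · simpa [dist_eq_norm] using (hn w hw).le

/-- A finite product of integer powers `(w - a) ^ D a` whose centres lie outside a disc has a
holomorphic logarithm on that disc. -/
theorem exists_differentiableOn_exp_eq_prod_sub_zpow (D : ℂ → ℤ) (s : Finset ℂ) {R : ℝ}
    (hs : ∀ a ∈ s, R ≤ ‖a‖) :
    ∃ L : ℂ → ℂ, DifferentiableOn ℂ L (ball 0 R) ∧
      ∀ w ∈ ball (0 : ℂ) R, Complex.exp (L w) = ∏ a ∈ s, (w - a) ^ D a := by
  have hlt : ∀ a ∈ s, ∀ w ∈ ball (0 : ℂ) R, ‖w‖ < ‖a‖ := fun a ha w hw ↦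
    (mem_ball_zero_iff.1 hw).trans_le (hs a ha)
  have hslit : ∀ a ∈ s, ∀ w ∈ ball (0 : ℂ) R, 1 - w / a ∈ Complex.slitPlane := by
    intro a ha w hw
    have hwa := hlt a ha w hw
    rw [sub_eq_add_neg]
    refine Complex.mem_slitPlane_of_norm_lt_one ?_
    rwa [norm_neg, norm_div, div_lt_one ((norm_nonneg w).trans_lt hwa)]
  refine ⟨fun w ↦ ∑ a ∈ s, (D a : ℂ) * (Complex.log (-a) + Complex.log (1 - w / a)),
    DifferentiableOn.fun_sum fun a ha ↦ ?_, fun w hw ↦ ?_⟩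
  · exact (((differentiableOn_id.div_const a).const_sub 1).clog (hslit a ha)).const_add _
      |>.const_mul _
  · rw [Complex.exp_sum]
    refine Finset.prod_congr rfl fun a ha ↦ ?_
    have ha0 : a ≠ 0 := norm_pos_iff.1 ((norm_nonneg w).trans_lt (hlt a ha w hw))
    rw [Complex.exp_int_mul, Complex.exp_add, Complex.exp_log (neg_ne_zero.2 ha0),
      Complex.exp_log (Complex.slitPlane_ne_zero (hslit a ha w hw))]
    congr 1
    field_simp
    ring

/-- An infinite product of nowhere vanishing entire functions `exp (p n)` and finite products of
powers `(w - a) ^ D a` is, near the point `z`, the product of `(w - z) ^ D z` and a nonvanishing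
holomorphic function, provided its tail is the exponential of a normally convergent series. -/
theorem exists_analyticAt_eventually_tprod_eq (D : ℂ → ℤ) (A : ℕ → Finset ℂ)
    (hA : ∀ n a, a ∈ A n ↔ D a ≠ 0 ∧ ⌊‖a‖⌋₊ = n) {p h : ℕ → ℂ → ℂ} {u : ℕ → ℝ}
    (hp : ∀ n, Differentiable ℂ (p n))
    (hh : ∀ n : ℕ, DifferentiableOn ℂ (h n) (ball 0 ((n : ℝ) - 1)))
    (hu : Summable u) (hhu : ∀ n : ℕ, ∀ w ∈ ball (0 : ℂ) ((n : ℝ) - 1), ‖h n w‖ ≤ u n)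
    (hexp : ∀ n : ℕ, ∀ w ∈ ball (0 : ℂ) ((n : ℝ) - 1),
      (∏ a ∈ A n, (w - a) ^ D a) * Complex.exp (p n w) = Complex.exp (h n w)) (z : ℂ) :
    ∃ g : ℂ → ℂ, AnalyticAt ℂ g z ∧ g z ≠ 0 ∧ ∀ᶠ w in 𝓝 z,
      ∏' n, (∏ a ∈ A n, (w - a) ^ D a) * Complex.exp (p n w) = (w - z) ^ D z * g w := by
  classical
  obtain ⟨N, hN⟩ := exists_nat_gt ‖z‖
  have hsub : ∀ n, ball (0 : ℂ) N ⊆ ball 0 (((n + (N + 1) : ℕ) : ℝ) - 1) := fun n ↦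
    ball_subset_ball (by push_cast; linarith [n.cast_nonneg (α := ℝ)])
  have hu' : Summable fun n ↦ u (n + (N + 1)) := (summable_nat_add_iff _).2 hu
  set T : Finset ℂ := (Finset.range (N + 1)).biUnion A with hT
  have hzT : z ∉ T → D z = 0 := by
    intro hz
    by_contra hDz
    refine hz (Finset.mem_biUnion.2 ⟨⌊‖z‖⌋₊, ?_, (hA _ _).2 ⟨hDz, rfl⟩⟩)
    exact Finset.mem_range.2 (Nat.lt_succ_of_le (Nat.floor_le_of_le hN.le))
  have hdisj : Set.PairwiseDisjoint (↑(Finset.range (N + 1))) A := by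
    intro m _ n _ hmn
    refine Finset.disjoint_left.2 fun a ham han ↦ hmn ?_
    rw [← ((hA m a).1 ham).2, ((hA n a).1 han).2]
  have hfactor : ∀ w, ∏ a ∈ T, (w - a) ^ D a
      = (w - z) ^ D z * ∏ a ∈ T.erase z, (w - a) ^ D a := by
    intro w
    by_cases hz : z ∈ T
    · exact (Finset.mul_prod_erase T _ hz).symm
    · simp [hzT hz, Finset.erase_eq_of_notMem hz]
  refine ⟨fun w ↦ (∏ a ∈ T.erase z, (w - a) ^ D a) *
    (Complex.exp (∑ n ∈ Finset.range (N + 1), p n w) *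
      Complex.exp (∑' n, h (n + (N + 1)) w)), ?_, ?_, ?_⟩
  · refine AnalyticAt.fun_mul (Finset.analyticAt_fun_prod _ fun a ha ↦ ?_)
      (AnalyticAt.fun_mul ?_ ?_)
    · exact AnalyticAt.fun_zpow (by fun_prop) (sub_ne_zero.2 (Finset.ne_of_mem_erase ha).symm)
    · exact (Differentiable.fun_sum fun n _ ↦ hp n).cexp.analyticAt z
    · exact (Complex.differentiableOn_tsum_of_summable_norm hu' (fun n ↦ (hh _).mono (hsub n))
        isOpen_ball fun n w hw ↦ hhu _ w (hsub n hw)).cexp.analyticAt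
          (isOpen_ball.mem_nhds (mem_ball_zero_iff.2 hN))
  · refine mul_ne_zero (Finset.prod_ne_zero_iff.2 fun a ha ↦ ?_)
      (mul_ne_zero (Complex.exp_ne_zero _) (Complex.exp_ne_zero _))
    exact zpow_ne_zero _ (sub_ne_zero.2 (Finset.ne_of_mem_erase ha).symm)
  · filter_upwards [isOpen_ball.mem_nhds (mem_ball_zero_iff.2 hN)] with w hw
    have hsum : Summable fun n ↦ h (n + (N + 1)) w :=
      hu'.of_norm_bounded fun n ↦ hhu _ w (hsub n hw)
    have htail : HasProd (fun n ↦ (∏ a ∈ A (n + (N + 1)), (w - a) ^ D a) *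
        Complex.exp (p (n + (N + 1)) w)) (Complex.exp (∑' n, h (n + (N + 1)) w)) := by
      simpa only [Function.comp_def, ← hexp _ w (hsub _ hw)] using hsum.hasSum.cexp
    rw [(HasProd.prod_range_mul (f := fun n ↦ (∏ a ∈ A n, (w - a) ^ D a) * Complex.exp (p n w))
      htail).tprod_eq, Finset.prod_mul_distrib, ← Finset.prod_biUnion hdisj, ← hT, hfactor,
      Complex.exp_sum]
    ring

/--
Let `D : ℂ → ℤ` be a function whose support `{z : D z ≠ 0}` is a closed, discrete subset
of `ℂ`.  Then there exists a function `f`, meromorphic on all of `ℂ` and not identically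
zero, such that for every `z ∈ ℂ` the order of `f` at `z` equals `D z`: that is, near `z`
one has `f w = (w - z) ^ (D z) * g w` with `g` holomorphic and nonvanishing at `z`.
-/
theorem exists_meromorphic_with_prescribed_orders
    (D : ℂ → ℤ)
    (hclosed : IsClosed {z : ℂ | D z ≠ 0})
    (hdisc : DiscreteTopology {z : ℂ | D z ≠ 0}) :
    ∃ f : ℂ → ℂ,
      (∀ z : ℂ, MeromorphicAt f z) ∧
      (∃ z : ℂ, f z ≠ 0) ∧
      ∀ z : ℂ, ∃ g : ℂ → ℂ, AnalyticAt ℂ g z ∧ g z ≠ 0 ∧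
        ∀ᶠ w in nhdsWithin z {z}ᶜ, f w = (w - z) ^ (D z) * g w := by
  have hfin (n : ℕ) : {a : ℂ | D a ≠ 0 ∧ ⌊‖a‖⌋₊ = n}.Finite := by
    have hcompact : IsCompact ({z : ℂ | D z ≠ 0} ∩ closedBall 0 ((n : ℝ) + 1)) :=
      (isCompact_closedBall 0 _).inter_left hclosed
    refine (hcompact.finite (IsDiscrete.mono ⟨hdisc⟩ Set.inter_subset_left)).subset ?_
    rintro a ⟨ha, rfl⟩
    exact ⟨ha, mem_closedBall_zero_iff.2 (Nat.lt_floor_add_one _).le⟩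
  set A : ℕ → Finset ℂ := fun n ↦ (hfin n).toFinset
  have hA : ∀ n a, a ∈ A n ↔ D a ≠ 0 ∧ ⌊‖a‖⌋₊ = n := by simp [A]
  have hnorm (n : ℕ) : ∀ a ∈ A n, (n : ℝ) ≤ ‖a‖ := by
    intro a ha
    rw [← ((hA n a).1 ha).2]
    exact Nat.floor_le (norm_nonneg a)
  choose L hL hLexp using fun n ↦
    exists_differentiableOn_exp_eq_prod_sub_zpow D (A n) (hnorm n)
  choose q hq hqL using fun n : ℕ ↦
    (hL n).exists_differentiable_norm_sub_le (sub_one_lt (n : ℝ)) (pow_pos one_half_pos n)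
  have hsub (n : ℕ) : ball (0 : ℂ) ((n : ℝ) - 1) ⊆ ball 0 n :=
    ball_subset_ball (sub_one_lt (n : ℝ)).le
  have hlocal := exists_analyticAt_eventually_tprod_eq D A hA (p := fun n w ↦ -q n w)
    (h := fun n w ↦ L n w - q n w) (fun n ↦ (hq n).fun_neg)
    (fun n ↦ ((hL n).mono (hsub n)).fun_sub (hq n).differentiableOn) summable_geometric_two hqL
    (fun n w hw ↦ by rw [sub_eq_add_neg, Complex.exp_add, hLexp n w (hsub n hw)])
  set f : ℂ → ℂ := fun w ↦ ∏' n, (∏ a ∈ A n, (w - a) ^ D a) * Complex.exp (-q n w)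
  refine ⟨f, fun z ↦ ?_, ?_, fun z ↦ ?_⟩
  · obtain ⟨g, hg, -, hfg⟩ := hlocal z
    have hmero : MeromorphicAt (fun w ↦ (w - z) ^ D z * g w) z := by fun_prop
    exact hmero.congr ((hfg.filter_mono nhdsWithin_le_nhds).mono fun _ hw ↦ hw.symm)
  · obtain ⟨g, hg, hg0, hfg⟩ := hlocal 0
    obtain ⟨w, ⟨hfw, hgw⟩, hw⟩ := (((hfg.and (hg.continuousAt.eventually_ne hg0)).filter_mono
      (nhdsWithin_le_nhds (s := {0}ᶜ))).and self_mem_nhdsWithin).exists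
    exact ⟨w, hfw.trans_ne (mul_ne_zero (zpow_ne_zero _ (sub_ne_zero.2 hw)) hgw)⟩
  · obtain ⟨g, hg, hg0, hfg⟩ := hlocal z
    exact ⟨g, hg, hg0, hfg.filter_mono nhdsWithin_le_nhds⟩
end

section
/- Let (x_n)_{n∈ℕ} be a sequence of pairwise distinct points of ℂ whose image {x_n : n ∈ ℕ} is a closed, discrete subset of ℂ, and let (c_n)_{n∈ℕ} be an arbitrary sequence of complex numbers. Then there exists an entire function f : ℂ → ℂ such that f(x_n) = c_n for every n ∈ ℕ. -/
open Filter Topology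

/-- An entire function with prescribed value at `a`, vanishing on a finite set avoiding `a`, and
arbitrarily small on the open disc of radius `‖a‖ / 2`. -/
theorem exists_entire_eq_and_eq_zero_and_norm_le (s : Finset ℂ) {a : ℂ} (ha : a ∉ s) (v : ℂ)
    {ε : ℝ} (hε : 0 < ε) :
    ∃ g : ℂ → ℂ, Differentiable ℂ g ∧ g a = v ∧ (∀ b ∈ s, g b = 0) ∧
      ∀ z, ‖z‖ < ‖a‖ / 2 → ‖g z‖ ≤ ε := by
  set q : ℂ → ℂ := fun z => ∏ b ∈ s, (z - b)
  have hqd : Differentiable ℂ q := by fun_prop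
  have hqa : q a ≠ 0 := Finset.prod_ne_zero_iff.2 fun b hb =>
    sub_ne_zero.2 fun h => ha (h ▸ hb)
  have hqs : ∀ b ∈ s, q b = 0 := fun b hb => Finset.prod_eq_zero hb (sub_self b)
  rcases eq_or_ne a 0 with rfl | ha0
  · refine ⟨fun z => v / q 0 * q z, by fun_prop, by field_simp, fun b hb => by simp [hqs b hb],
      fun z hz => ?_⟩
    simp only [norm_zero, zero_div] at hz
    exact absurd hz (norm_nonneg z).not_gt
  · obtain ⟨C, hC⟩ := (isCompact_closedBall (0 : ℂ) (‖a‖ / 2)).exists_bound_of_continuousOn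
      (f := fun z => v / q a * q z) (by fun_prop)
    have hlim : Tendsto (fun m : ℕ => C * (1 / 2 : ℝ) ^ m) atTop (𝓝 0) := by
      simpa using (tendsto_pow_atTop_nhds_zero_of_lt_one (r := (1 / 2 : ℝ))
        (by norm_num) (by norm_num)).const_mul C
    obtain ⟨m, hm⟩ := (hlim.eventually_lt_const hε).exists
    refine ⟨fun z => v / q a * q z * (z / a) ^ m, by fun_prop, by simp [ha0, hqa],
      fun b hb => by simp [hqs b hb], fun z hz => ?_⟩
    have hza : ‖z / a‖ ≤ 1 / 2 := by
      rw [norm_div, div_le_iff₀ (norm_pos_iff.2 ha0)]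
      linarith
    have hz' := hC z (by simpa using hz.le)
    rw [norm_mul, norm_pow]
    calc _ ≤ C * (1 / 2 : ℝ) ^ m := by
          gcongr
          exact (norm_nonneg _).trans hz'
      _ ≤ ε := hm.le

/-- A series of entire functions dominated on every disc by a summable sequence, up to finitely
many terms, has an entire sum. -/
theorem differentiable_tsum_of_eventually_norm_le {ι : Type*} {p : ι → ℂ → ℂ} {u : ι → ℝ}
    (hu : Summable u) (hp : ∀ i, Differentiable ℂ (p i))
    (hpu : ∀ R : ℝ, ∀ᶠ i in cofinite, ∀ z, ‖z‖ < R → ‖p i z‖ ≤ u i) :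
    Differentiable ℂ fun z => ∑' i, p i z := by
  classical
  intro z
  set R := ‖z‖ + 1 with hR
  have hbound : ∀ i, ∃ M, ∀ w ∈ Metric.closedBall (0 : ℂ) R, ‖p i w‖ ≤ M := fun i =>
    (isCompact_closedBall 0 R).exists_bound_of_continuousOn (hp i).continuous.continuousOn
  choose M hM using hbound
  have hsum : Summable fun i => if ∀ w, ‖w‖ < R → ‖p i w‖ ≤ u i then u i else M i :=
    hu.congr_cofinite ((hpu R).mono fun i hi => (if_pos hi).symm)
  refine (Complex.differentiableOn_tsum_of_summable_norm hsum
    (fun i => (hp i).differentiableOn) (Metric.isOpen_ball (x := (0 : ℂ)) (ε := R))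
    fun i w hw => ?_).differentiableAt (Metric.isOpen_ball.mem_nhds (by simp [hR]))
  split_ifs with h
  · exact h w (by simpa using hw)
  · exact hM i w (Metric.ball_subset_closedBall hw)

/--
Let `(x_n)_{n ∈ ℕ}` be a sequence of pairwise distinct points of `ℂ` whose image
`{x_n : n ∈ ℕ}` is a closed, discrete subset of `ℂ`, and let `(c_n)_{n ∈ ℕ}` be an arbitrary
sequence of complex numbers.  Then there exists an entire function `f : ℂ → ℂ` such that
`f (x_n) = c_n` for every `n ∈ ℕ`.
-/
theorem exists_entire_interpolating
    (x : ℕ → ℂ) (hx : Function.Injective x)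
    (hclosed : IsClosed (Set.range x))
    (hdisc : DiscreteTopology (Set.range x))
    (c : ℕ → ℂ) :
    ∃ f : ℂ → ℂ, Differentiable ℂ f ∧ ∀ n : ℕ, f (x n) = c n := by
  classical
  have hmem : ∀ n, x n ∉ (Finset.range n).image x := fun n h => by
    obtain ⟨k, hk, hkn⟩ := Finset.mem_image.1 h
    exact (Finset.mem_range.1 hk).ne (hx hkn)
  choose g hgd hga hgs hgn using fun (n : ℕ) (v : ℂ) =>
    exists_entire_eq_and_eq_zero_and_norm_le _ (hmem n) v (ε := (1 / 2 : ℝ) ^ n) (by positivity)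
  let F : ℕ → ℂ → ℂ := fun n =>
    Nat.rec 0 (fun k G z => G z + g k (c k - G (x k)) z) n
  let p : ℕ → ℂ → ℂ := fun n => g n (c n - F n (x n))
  have hF : ∀ n z, F n z = ∑ k ∈ Finset.range n, p k z := fun n z => by
    induction n with
    | zero => rfl
    | succ n ih => rw [Finset.sum_range_succ, ← ih]
  refine ⟨fun z => ∑' n, p n z, differentiable_tsum_of_eventually_norm_le
    summable_geometric_two (fun n => hgd n _) fun R => ?_, fun n => ?_⟩
  · have hfin : (Metric.closedBall (0 : ℂ) (2 * R) ∩ Set.range x).Finite :=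
      ((isCompact_closedBall 0 (2 * R)).inter_right hclosed).finite
        (IsDiscrete.mono ⟨hdisc⟩ Set.inter_subset_right)
    filter_upwards [(hfin.preimage hx.injOn).compl_mem_cofinite] with n hn z hz
    refine hgn n _ z ?_
    have : 2 * R < ‖x n‖ := by simpa using hn
    linarith
  · change ∑' k, p k (x n) = c n
    rw [tsum_eq_sum (s := Finset.range (n + 1)), Finset.sum_range_succ, ← hF]
    · simp [p, hga]
    · intro k hk
      refine hgs k _ _ (Finset.mem_image_of_mem x ?_)
      simp only [Finset.mem_range] at hk ⊢
      lia
end
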